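/- arXiv:1605.07101 — 2 statements merged into one kernel-verified Lean document; each statement's English description precedes it below -/
import Mathlib

section
/- Let ω be a free ultrafilter on ℕ, let (n_k) be a sequence of positive integers with n_k → ∞, and let u_k, v_k ∈ M_{n_k}(ℂ) be unitary matrices for each k. Then the following are equivalent: (a) there exist unitary matrices w_k ∈ M_{n_k}(ℂ) such that ‖w_k u_k w_k* − v_k‖₂ converges to 0 along ω; (b) for every m ∈ ℤ, Tr(u_k^m) − Tr(v_k^m) converges to 0 along ω. -/
open Filter

/-- The normalized trace `Tr(A) = (1/n) ∑ᵢ aᵢᵢ`. -/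
noncomputable def nTr {n : ℕ} (A : Matrix (Fin n) (Fin n) ℂ) : ℂ :=
  Matrix.trace A / n

/-- The normalized trace norm `‖A‖₂ = √((1/n) ∑_{i,j} |a_{ij}|²)`. -/
noncomputable def trNorm {n : ℕ} (A : Matrix (Fin n) (Fin n) ℂ) : ℝ :=
  Real.sqrt ((∑ i, ∑ j, Complex.normSq (A i j)) / n)

theorem Matrix.inv_eq_star_of_mem_unitaryGroup {n : Type*} [Fintype n] [DecidableEq n]
    {U : Matrix n n ℂ} (hU : U ∈ Matrix.unitaryGroup n ℂ) : U⁻¹ = star U :=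
  Matrix.inv_eq_right_inv (Matrix.mem_unitaryGroup_iff.1 hU)

open Matrix.Norms.L2Operator in
/-- A unitary matrix is unitarily diagonalizable, with eigenvalues of the form `exp (i t)`. -/
theorem Matrix.exists_real_exp_diagonalization_of_mem_unitaryGroup {n : Type*} [Fintype n]
    [DecidableEq n] {u : Matrix n n ℂ} (hu : u ∈ Matrix.unitaryGroup n ℂ) :
    ∃ W ∈ Matrix.unitaryGroup n ℂ, ∃ t : n → ℝ,
      u = W * Matrix.diagonal (fun i => Complex.exp (Complex.I * t i)) * star W := by
  have : IsStarNormal u := ⟨by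
    rw [commute_iff_eq, Matrix.mem_unitaryGroup_iff.1 hu, Matrix.mem_unitaryGroup_iff'.1 hu]⟩
  have hfin : (spectrum ℂ u).Finite := Matrix.finite_spectrum u
  have harg : ContinuousOn (fun z : ℂ => (z.arg : ℂ)) (spectrum ℂ u) := hfin.continuousOn _
  set H : Matrix n n ℂ := cfc (fun z : ℂ => (z.arg : ℂ)) u with hHdef
  have hHsa : IsSelfAdjoint H := IsSelfAdjoint.cfc_arg u
  have hH : H.IsHermitian := hHsa
  have hexp : NormedSpace.exp (Complex.I • H) = u := by
    have := hHsa.isStarNormal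
    rw [← CFC.exp_eq_normedSpace_exp (𝕜 := ℂ), ← cfc_comp_smul Complex.I _ H, hHdef, ← cfc_comp' ..]
    conv_rhs => rw [← cfc_id' ℂ u]
    refine cfc_congr fun y hy ↦ ?_
    have hy₁ : ‖y‖ = 1 := spectrum.norm_eq_one_of_unitary hu hy
    have : Complex.I * y.arg = Complex.log y :=
      Complex.ext (by simp [Complex.log_re, hy₁]) (by simp [Complex.log_im])
    simpa [← Complex.exp_eq_exp_ℂ, this] using Complex.exp_log (by rintro rfl; simp at hy₁)
  refine ⟨hH.eigenvectorUnitary, hH.eigenvectorUnitary.2, hH.eigenvalues, ?_⟩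
  have hinv : (hH.eigenvectorUnitary : Matrix n n ℂ)⁻¹ =
      star (hH.eigenvectorUnitary : Matrix n n ℂ) :=
    Matrix.inv_eq_star_of_mem_unitaryGroup hH.eigenvectorUnitary.2
  have hunit : IsUnit (hH.eigenvectorUnitary : Matrix n n ℂ) :=
    IsUnit.of_mul_eq_one _ (Matrix.mem_unitaryGroup_iff.1 hH.eigenvectorUnitary.2)
  conv_lhs => rw [← hexp, hH.spectral_theorem, Unitary.conjStarAlgAut_apply, ← Matrix.smul_mul,
    ← Matrix.mul_smul]
  rw [← Matrix.diagonal_smul, ← hinv, Matrix.exp_conj _ _ hunit,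
    Matrix.exp_diagonal]
  congr 3
  ext i
  simp [Pi.coe_exp, ← Complex.exp_eq_exp_ℂ]

/-- A unitary matrix is unitarily diagonalizable with eigenvalues on the unit circle. -/
theorem Matrix.exists_diagonalization_of_mem_unitaryGroup {n : Type*} [Fintype n]
    [DecidableEq n] {u : Matrix n n ℂ} (hu : u ∈ Matrix.unitaryGroup n ℂ) :
    ∃ W ∈ Matrix.unitaryGroup n ℂ, ∃ x : n → UnitAddCircle,
      u = W * Matrix.diagonal (fun i => fourier 1 (x i)) * star W := by
  obtain ⟨W, hW, t, rfl⟩ := Matrix.exists_real_exp_diagonalization_of_mem_unitaryGroup hu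
  refine ⟨W, hW, fun i => ((t i / (2 * Real.pi) : ℝ) : UnitAddCircle), ?_⟩
  congr 3
  ext i
  rw [fourier_coe_apply]
  congr 1
  have := Real.pi_ne_zero
  push_cast
  field_simp

/-- Two families of points of equal size whose sums against each member of a partition of unity
nearly agree can be matched at small cost. -/
theorem exists_perm_sum_cost_le {X ι κ : Type*} [Fintype ι] [DecidableEq ι] [Fintype κ]
    (φ : κ → X → ℝ) (hφ : ∀ j x, 0 ≤ φ j x) (hφ1 : ∀ x, ∑ j, φ j x = 1)
    (c : X → X → ℝ) {B ε : ℝ} (hB : ∀ x y, c x y ≤ B) (hB0 : 0 ≤ B) (hε : 0 ≤ ε)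
    (hc : ∀ j x y, φ j x * φ j y ≠ 0 → c x y ≤ ε) (x y : ι → X) :
    ∃ σ : Equiv.Perm ι, ∑ i, c (x i) (y (σ i)) ≤
      ε * Fintype.card ι + B * ∑ j, |∑ i, φ j (x i) - ∑ i, φ j (y i)| := by
  classical
  set S : κ → ℝ := fun j => ∑ i, φ j (x i) with hS
  set S' : κ → ℝ := fun j => ∑ i, φ j (y i) with hS'
  have hS0 : ∀ j, 0 ≤ S j := fun j => Finset.sum_nonneg fun i _ => hφ _ _
  set m : κ → ℝ := fun j => max (S j) (S' j) with hm
  have hm0 : ∀ j, 0 ≤ m j := fun j => (hS0 j).trans (le_max_left _ _)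
  set P : ι → ι → ℝ := fun i l => ∑ j, φ j (x i) * φ j (y l) / m j with hP
  have hP0 : ∀ i l, 0 ≤ P i l := fun i l => Finset.sum_nonneg fun j _ =>
    div_nonneg (mul_nonneg (hφ _ _) (hφ _ _)) (hm0 j)
  have hrow : ∀ i, ∑ l, P i l = ∑ j, φ j (x i) * (S' j / m j) := by
    intro i
    rw [hP, Finset.sum_comm]
    refine Finset.sum_congr rfl fun j _ => ?_
    rw [← Finset.sum_div, ← Finset.mul_sum, mul_div_assoc]
  have hcol : ∀ l, ∑ i, P i l = ∑ j, φ j (y l) * (S j / m j) := by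
    intro l
    rw [hP, Finset.sum_comm]
    refine Finset.sum_congr rfl fun j _ => ?_
    rw [← Finset.sum_div, ← Finset.sum_mul]
    ring
  set R : ι → ℝ := fun i => 1 - ∑ l, P i l with hR
  set C : ι → ℝ := fun l => 1 - ∑ i, P i l with hC
  have hR0 : ∀ i, 0 ≤ R i := by
    intro i
    rw [hR]; dsimp only
    rw [sub_nonneg, hrow, ← hφ1 (x i)]
    refine Finset.sum_le_sum fun j _ => mul_le_of_le_one_right (hφ _ _) ?_
    exact div_le_one_of_le₀ (le_max_right _ _) (hm0 j)
  have hC0 : ∀ i, 0 ≤ C i := by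
    intro i
    rw [hC]; dsimp only
    rw [sub_nonneg, hcol, ← hφ1 (y i)]
    refine Finset.sum_le_sum fun j _ => mul_le_of_le_one_right (hφ _ _) ?_
    exact div_le_one_of_le₀ (le_max_left _ _) (hm0 j)
  set D : ℝ := ∑ i, R i with hD
  have hD0 : 0 ≤ D := Finset.sum_nonneg fun i _ => hR0 i
  have hDC : ∑ l, C l = D := by
    rw [hD, hC, hR]
    simp only [Finset.sum_sub_distrib]
    rw [Finset.sum_comm]
  have hRD : ∀ i, R i * (D / D) = R i := by
    intro i
    rcases eq_or_ne D 0 with h | h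
    · rw [(Finset.sum_eq_zero_iff_of_nonneg fun i _ => hR0 i).1 h i (Finset.mem_univ i), zero_mul]
    · rw [div_self h, mul_one]
  have hCD : ∀ i, C i * (D / D) = C i := by
    intro i
    rcases eq_or_ne D 0 with h | h
    · rw [(Finset.sum_eq_zero_iff_of_nonneg fun i _ => hC0 i).1 (hDC.trans h) i
        (Finset.mem_univ i), zero_mul]
    · rw [div_self h, mul_one]
  have hDle : D ≤ ∑ j, |S j - S' j| := by
    have : D = ∑ j, (S j - S j * (S' j / m j)) := by
      rw [hD, hR]
      simp only [hrow]
      rw [Finset.sum_sub_distrib, Finset.sum_comm, Finset.sum_sub_distrib]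
      congr 1
      · simp only [hS]
        rw [Finset.sum_comm]
        simp [hφ1]
      · exact Finset.sum_congr rfl fun j _ => by rw [← Finset.sum_mul]
    rw [this]
    refine Finset.sum_le_sum fun j _ => ?_
    rcases le_total (S j) (S' j) with h | h
    · have hmj : m j = S' j := max_eq_right h
      rw [hmj]
      rcases eq_or_ne (S' j) 0 with h0 | h0
      · have : S j = 0 := le_antisymm (h.trans h0.le) (hS0 j)
        simp [this, h0]
      · rw [div_self h0]; simp
    · have hmj : m j = S j := max_eq_left h
      rw [hmj]
      rcases eq_or_ne (S j) 0 with h0 | h0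
      · simp [h0]
      · rw [mul_div_cancel₀ _ h0]; exact le_abs_self _
  set M : Matrix ι ι ℝ := Matrix.of fun i l => P i l + R i * C l / D with hM
  have hMds : M ∈ doublyStochastic ℝ ι := by
    rw [mem_doublyStochastic_iff_sum]
    refine ⟨fun i l => add_nonneg (hP0 i l) (div_nonneg (mul_nonneg (hR0 i) (hC0 l)) hD0),
      fun i => ?_, fun l => ?_⟩
    · simp only [hM, Matrix.of_apply, Finset.sum_add_distrib, ← Finset.sum_div, ← Finset.mul_sum]
      rw [hDC, mul_div_assoc, hRD]; simp [hR]
    · simp only [hM, Matrix.of_apply, Finset.sum_add_distrib, ← Finset.sum_div, ← Finset.sum_mul]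
      rw [← hD, mul_comm, mul_div_assoc, hCD]; simp [hC]
  have hcost : ∑ i, ∑ l, M i l * c (x i) (y l) ≤ ε * Fintype.card ι + B * D := by
    have h1 : ∀ i l, M i l * c (x i) (y l) ≤ ε * P i l + B * (R i * C l / D) := by
      intro i l
      simp only [hM, Matrix.of_apply, add_mul]
      refine add_le_add ?_ ?_
      · simp only [hP]
        rw [Finset.sum_mul, Finset.mul_sum]
        refine Finset.sum_le_sum fun j _ => ?_
        by_cases h : φ j (x i) * φ j (y l) = 0
        · simp [h]
        · rw [mul_comm]
          exact mul_le_mul_of_nonneg_right (hc j _ _ h)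
            (div_nonneg (mul_nonneg (hφ _ _) (hφ _ _)) (hm0 j))
      · rw [mul_comm]
        exact mul_le_mul_of_nonneg_right (hB _ _) (div_nonneg (mul_nonneg (hR0 i) (hC0 l)) hD0)
    calc _ ≤ ∑ i, ∑ l, (ε * P i l + B * (R i * C l / D)) :=
          Finset.sum_le_sum fun i _ => Finset.sum_le_sum fun l _ => h1 i l
      _ = ε * ∑ i, ∑ l, P i l + B * D := by
          simp only [Finset.sum_add_distrib, ← Finset.sum_div, ← Finset.mul_sum]
          rw [hDC, ← Finset.sum_mul, ← hD]
          rcases eq_or_ne D 0 with h | h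
          · simp [h]
          · rw [mul_div_assoc, div_self h, mul_one]
      _ ≤ _ := by
          gcongr
          have : ∑ i, ∑ l, P i l ≤ ∑ i : ι, (1 : ℝ) :=
            Finset.sum_le_sum fun i _ => sub_nonneg.1 (hR0 i)
          simpa using this
  obtain ⟨w, hw0, hw1, hwM⟩ := exists_eq_sum_perm_of_mem_doublyStochastic hMds
  have hexp : ∑ σ : Equiv.Perm ι, w σ * ∑ i, c (x i) (y (σ i)) =
      ∑ i, ∑ l, M i l * c (x i) (y l) := by
    rw [← hwM]
    simp only [Matrix.sum_apply, Matrix.smul_apply, Finset.sum_mul, smul_eq_mul]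
    simp_rw [Finset.sum_comm (s := Finset.univ (α := ι)) (t := Finset.univ (α := Equiv.Perm ι))]
    refine Finset.sum_congr rfl fun σ _ => ?_
    rw [Finset.mul_sum]
    refine Finset.sum_congr rfl fun i _ => ?_
    simp [Equiv.toPEquiv_apply, PEquiv.toMatrix_apply]
  by_contra! hcon
  have hlt : ∑ σ : Equiv.Perm ι, w σ * (ε * Fintype.card ι + B * ∑ j, |S j - S' j|) <
      ∑ σ : Equiv.Perm ι, w σ * ∑ i, c (x i) (y (σ i)) := by
    obtain ⟨σ, hσ⟩ : ∃ σ, 0 < w σ := by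
      by_contra! h
      have := Finset.sum_nonpos fun σ (_ : σ ∈ Finset.univ) => h σ
      linarith
    exact Finset.sum_lt_sum (fun σ _ => mul_le_mul_of_nonneg_left (hcon σ).le (hw0 σ))
      ⟨σ, Finset.mem_univ _, mul_lt_mul_of_pos_left (hcon σ) hσ⟩
  rw [← Finset.sum_mul, hw1, one_mul, hexp] at hlt
  have := mul_le_mul_of_nonneg_left hDle hB0
  linarith

/-- A continuous map on a compact space admits finite partitions of unity whose members are
supported on sets with small image. -/
theorem exists_partition_of_unity_small_image {X : Type*} [TopologicalSpace X] [CompactSpace X]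
    {E : Type*} [NormedAddCommGroup E] {f : X → E} (hf : Continuous f) {δ : ℝ} (hδ : 0 < δ) :
    ∃ (s : Finset X) (φ : s → C(X, ℝ)), (∀ j x, 0 ≤ φ j x) ∧ (∀ x, ∑ j, φ j x = 1) ∧
      ∀ j x y, φ j x * φ j y ≠ 0 → ‖f x - f y‖ ≤ δ := by
  obtain ⟨s, hs⟩ := CompactSpace.elim_nhds_subcover (fun p : X => {x | ‖f x - f p‖ < δ / 2})
    fun p => (isOpen_lt (by fun_prop) (by fun_prop)).mem_nhds (by simpa using hδ)
  let g : s → X → ℝ := fun j x => max 0 (δ / 2 - ‖f x - f j‖)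
  have hg0 : ∀ j x, 0 ≤ g j x := fun j x => le_max_left _ _
  have hgc : ∀ j, Continuous (g j) := fun j => by unfold g; fun_prop
  have hpos : ∀ x, 0 < ∑ j, g j x := by
    intro x
    have hx : x ∈ ⋃ p ∈ s, {x | ‖f x - f p‖ < δ / 2} := hs ▸ Set.mem_univ x
    simp only [Set.mem_iUnion, Set.mem_ofPred_eq] at hx
    obtain ⟨p, hp, hx⟩ := hx
    exact Finset.sum_pos' (fun j _ => hg0 j x)
      ⟨⟨p, hp⟩, Finset.mem_univ _, lt_max_of_lt_right (by simpa using hx)⟩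
  refine ⟨s, fun j => ⟨fun x => g j x / ∑ i, g i x,
    (hgc j).div (continuous_finsetSum _ fun i _ => hgc i) fun x => (hpos x).ne'⟩,
    fun j x => div_nonneg (hg0 j x) (hpos x).le, fun x => ?_, fun j x y h => ?_⟩
  · simp only [ContinuousMap.coe_mk]
    rw [← Finset.sum_div, div_self (hpos x).ne']
  · have key : ∀ z, g j z / ∑ i, g i z ≠ 0 → ‖f z - f j‖ ≤ δ / 2 := by
      intro z hz
      by_contra! hlt
      exact hz (by simp [g, max_eq_left (sub_nonpos.2 hlt.le)])
    have hx := key x (left_ne_zero_of_mul h)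
    have hy := key y (right_ne_zero_of_mul h)
    calc ‖f x - f y‖ = ‖(f x - f j) - (f y - f j)‖ := by congr 1; abel
      _ ≤ _ := (norm_sub_le _ _).trans (by linarith)

theorem trNorm_eq_sqrt_trace {n : ℕ} (A : Matrix (Fin n) (Fin n) ℂ) :
    trNorm A = Real.sqrt ((Matrix.trace (star A * A)).re / n) := by
  unfold trNorm
  congr 2
  rw [Finset.sum_comm]
  simp [Matrix.trace, Matrix.mul_apply, Matrix.star_apply, Complex.normSq_apply]

theorem trNorm_nonneg {n : ℕ} (A : Matrix (Fin n) (Fin n) ℂ) : 0 ≤ trNorm A :=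
  Real.sqrt_nonneg _

theorem trNorm_star {n : ℕ} (A : Matrix (Fin n) (Fin n) ℂ) : trNorm (star A) = trNorm A := by
  rw [trNorm_eq_sqrt_trace, trNorm_eq_sqrt_trace, star_star, Matrix.trace_mul_comm]

theorem trNorm_unitary_mul {n : ℕ} {U : Matrix (Fin n) (Fin n) ℂ}
    (hU : U ∈ Matrix.unitaryGroup (Fin n) ℂ) (A : Matrix (Fin n) (Fin n) ℂ) :
    trNorm (U * A) = trNorm A := by
  rw [trNorm_eq_sqrt_trace, trNorm_eq_sqrt_trace, star_mul, mul_assoc, ← mul_assoc (star U),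
    Matrix.mem_unitaryGroup_iff'.1 hU, one_mul]

theorem trNorm_mul_unitary {n : ℕ} {U : Matrix (Fin n) (Fin n) ℂ}
    (hU : U ∈ Matrix.unitaryGroup (Fin n) ℂ) (A : Matrix (Fin n) (Fin n) ℂ) :
    trNorm (A * U) = trNorm A := by
  rw [← trNorm_star, star_mul, trNorm_unitary_mul (Unitary.star_mem hU), trNorm_star]

theorem trNorm_diagonal {n : ℕ} (d : Fin n → ℂ) :
    trNorm (Matrix.diagonal d) = Real.sqrt ((∑ i, ‖d i‖ ^ 2) / n) := by
  rw [trNorm_eq_sqrt_trace]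
  congr 2
  simp [Matrix.star_eq_conjTranspose, Matrix.diagonal_conjTranspose, Matrix.trace_diagonal,
    ← Complex.normSq_eq_norm_sq, Complex.normSq_apply]

open Matrix.Norms.Frobenius in
theorem trNorm_add_le {n : ℕ} (A B : Matrix (Fin n) (Fin n) ℂ) :
    trNorm (A + B) ≤ trNorm A + trNorm B := by
  have h : ∀ A : Matrix (Fin n) (Fin n) ℂ, trNorm A = ‖A‖ / Real.sqrt n := by
    intro A
    rw [trNorm, Real.sqrt_div' _ n.cast_nonneg, Matrix.frobenius_norm_def, Real.sqrt_eq_rpow]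
    simp [Complex.normSq_eq_norm_sq]
  rw [h, h, h, ← add_div]
  gcongr
  exact norm_add_le A B

theorem norm_nTr_le_trNorm {n : ℕ} (hn : 0 < n) (A : Matrix (Fin n) (Fin n) ℂ) :
    ‖nTr A‖ ≤ trNorm A := by
  have hn' : (0 : ℝ) < n := Nat.cast_pos.2 hn
  refine Real.le_sqrt_of_sq_le ?_
  rw [nTr, norm_div, Complex.norm_natCast, div_pow, div_le_div_iff₀ (by positivity) hn']
  have h1 : ‖A.trace‖ ^ 2 ≤ n * ∑ i, ‖A i i‖ ^ 2 := by
    calc ‖A.trace‖ ^ 2 ≤ (∑ i, ‖A i i‖) ^ 2 := by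
          gcongr
          exact norm_sum_le _ _
      _ ≤ _ := by simpa using sq_sum_le_card_mul_sum_sq (s := Finset.univ) (f := fun i => ‖A i i‖)
  have h2 : ∑ i, ‖A i i‖ ^ 2 ≤ ∑ i, ∑ j, Complex.normSq (A i j) := by
    refine Finset.sum_le_sum fun i _ => ?_
    rw [← Complex.normSq_eq_norm_sq]
    exact Finset.single_le_sum (f := fun j => Complex.normSq (A i j))
      (fun j _ => Complex.normSq_nonneg _) (Finset.mem_univ i)
  nlinarith [mul_le_mul_of_nonneg_left h2 (sq_nonneg (n : ℝ)), mul_le_mul_of_nonneg_right h1 hn'.le]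

theorem trNorm_pow_sub_pow_le {n : ℕ} {A B : Matrix (Fin n) (Fin n) ℂ}
    (hA : A ∈ Matrix.unitaryGroup (Fin n) ℂ) (hB : B ∈ Matrix.unitaryGroup (Fin n) ℂ) (m : ℕ) :
    trNorm (A ^ m - B ^ m) ≤ m * trNorm (A - B) := by
  induction m with
  | zero => simp [trNorm]
  | succ m ih =>
    have h : A ^ (m + 1) - B ^ (m + 1) = A ^ m * (A - B) + (A ^ m - B ^ m) * B := by
      rw [pow_succ, pow_succ]; noncomm_ring
    rw [h]
    refine (trNorm_add_le _ _).trans ?_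
    rw [trNorm_unitary_mul (pow_mem hA m), trNorm_mul_unitary hB]
    push_cast
    linarith

theorem nTr_star {n : ℕ} (A : Matrix (Fin n) (Fin n) ℂ) : nTr (star A) = star (nTr A) := by
  simp [nTr, Matrix.star_eq_conjTranspose, Matrix.trace_conjTranspose]

theorem nTr_conj {n : ℕ} {W : Matrix (Fin n) (Fin n) ℂ}
    (hW : W ∈ Matrix.unitaryGroup (Fin n) ℂ) (A : Matrix (Fin n) (Fin n) ℂ) :
    nTr (W * A * star W) = nTr A := by
  rw [nTr, Matrix.trace_mul_comm, ← mul_assoc, Matrix.mem_unitaryGroup_iff'.1 hW, one_mul, nTr]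

theorem unitary_conj_pow {n : ℕ} {W : Matrix (Fin n) (Fin n) ℂ}
    (hW : W ∈ Matrix.unitaryGroup (Fin n) ℂ) (A : Matrix (Fin n) (Fin n) ℂ) (m : ℕ) :
    (W * A * star W) ^ m = W * A ^ m * star W := by
  induction m with
  | zero => simp [Matrix.mem_unitaryGroup_iff.1 hW]
  | succ m ih =>
    rw [pow_succ, ih, pow_succ]
    simp only [mul_assoc]
    rw [← mul_assoc (star W) W, Matrix.mem_unitaryGroup_iff'.1 hW, one_mul]

/-- For negative exponents, the trace of a power of a unitary is the conjugate of that
of the positive power. -/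
theorem nTr_zpow_neg {n : ℕ} {U : Matrix (Fin n) (Fin n) ℂ}
    (hU : U ∈ Matrix.unitaryGroup (Fin n) ℂ) (m : ℕ) :
    nTr (U ^ (-(m : ℤ))) = star (nTr (U ^ m)) := by
  rw [Matrix.zpow_neg_natCast, Matrix.inv_eq_star_of_mem_unitaryGroup (pow_mem hU m), nTr_star]

/-- Moments of unitaries that are nearly unitarily conjugate nearly agree. -/
theorem norm_nTr_zpow_sub_le {n : ℕ} (hn : 0 < n) {u v w : Matrix (Fin n) (Fin n) ℂ}
    (hu : u ∈ Matrix.unitaryGroup (Fin n) ℂ) (hv : v ∈ Matrix.unitaryGroup (Fin n) ℂ)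
    (hw : w ∈ Matrix.unitaryGroup (Fin n) ℂ) (m : ℤ) :
    ‖nTr (u ^ m) - nTr (v ^ m)‖ ≤ m.natAbs * trNorm (w * u * star w - v) := by
  have key : ∀ m : ℕ, ‖nTr (u ^ m) - nTr (v ^ m)‖ ≤ m * trNorm (w * u * star w - v) := by
    intro m
    rw [← nTr_conj hw (u ^ m), ← unitary_conj_pow hw]
    have : ∀ A B : Matrix (Fin n) (Fin n) ℂ, nTr A - nTr B = nTr (A - B) := fun A B => by
      simp [nTr, sub_div]
    rw [this]
    exact (norm_nTr_le_trNorm hn _).trans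
      (trNorm_pow_sub_pow_le (mul_mem (mul_mem hw hu) (Unitary.star_mem hw)) hv m)
  obtain ⟨k, rfl | rfl⟩ := m.eq_nat_or_neg
  · simpa using key k
  · rw [nTr_zpow_neg hu, nTr_zpow_neg hv, ← star_sub, norm_star]
    simpa using key k

theorem nTr_zpow_conj_diagonal_fourier {n : ℕ} {W : Matrix (Fin n) (Fin n) ℂ}
    (hW : W ∈ Matrix.unitaryGroup (Fin n) ℂ) (x : Fin n → UnitAddCircle)
    (hu : W * Matrix.diagonal (fun i => fourier 1 (x i)) * star W ∈ Matrix.unitaryGroup (Fin n) ℂ)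
    (m : ℤ) :
    nTr ((W * Matrix.diagonal (fun i => fourier 1 (x i)) * star W) ^ m) =
      (∑ i, fourier m (x i)) / n := by
  have key : ∀ m : ℕ, nTr ((W * Matrix.diagonal (fun i => fourier 1 (x i)) * star W) ^ m) =
      (∑ i, fourier (m : ℤ) (x i)) / n := by
    intro m
    rw [unitary_conj_pow hW, nTr_conj hW, Matrix.diagonal_pow, nTr, Matrix.trace_diagonal]
    congr 2
    ext i
    rw [Pi.pow_apply, fourier_one, fourier_apply, AddCircle.toCircle_zsmul]
    simp
  obtain ⟨k, rfl | rfl⟩ := m.eq_nat_or_neg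
  · simpa using key k
  · rw [nTr_zpow_neg hu, key]
    simp only [fourier_neg]
    simp

/-- Matching the eigenvalues of two diagonalized unitaries by a permutation gives a conjugating
unitary. -/
theorem exists_unitary_trNorm_conj_sub_eq {n : ℕ} {U V : Matrix (Fin n) (Fin n) ℂ}
    (hU : U ∈ Matrix.unitaryGroup (Fin n) ℂ) (hV : V ∈ Matrix.unitaryGroup (Fin n) ℂ)
    (a b : Fin n → ℂ) (σ : Equiv.Perm (Fin n)) :
    ∃ w ∈ Matrix.unitaryGroup (Fin n) ℂ,
      trNorm (w * (U * Matrix.diagonal a * star U) * star w - V * Matrix.diagonal b * star V) =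
        Real.sqrt ((∑ i, ‖a i - b (σ i)‖ ^ 2) / n) := by
  set Q : Matrix (Fin n) (Fin n) ℂ := V.submatrix id σ with hQ
  have hstar : star Q = (star V).submatrix σ id := by
    rw [hQ, Matrix.star_eq_conjTranspose, Matrix.conjTranspose_submatrix,
      Matrix.star_eq_conjTranspose]
  have hQu : Q ∈ Matrix.unitaryGroup (Fin n) ℂ := by
    rw [Matrix.mem_unitaryGroup_iff, hstar, hQ, Matrix.submatrix_mul_equiv,
      Matrix.mem_unitaryGroup_iff.1 hV, Matrix.submatrix_id_id]
  have hVQ : V * Matrix.diagonal b * star V =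
      Q * Matrix.diagonal (fun i => b (σ i)) * star Q := by
    have : Matrix.diagonal (fun i => b (σ i)) = (Matrix.diagonal b).submatrix σ σ := by
      rw [Matrix.submatrix_diagonal_equiv]; rfl
    rw [hstar, hQ, this, Matrix.submatrix_mul_equiv, Matrix.submatrix_mul_equiv,
      Matrix.submatrix_id_id]
  refine ⟨Q * star U, mul_mem hQu (Unitary.star_mem hU), ?_⟩
  have hconj : Q * star U * (U * Matrix.diagonal a * star U) * star (Q * star U) =
      Q * Matrix.diagonal a * star Q := by
    have hUU := Matrix.mem_unitaryGroup_iff'.1 hU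
    rw [star_mul, star_star]
    calc _ = Q * ((star U * U) * Matrix.diagonal a * (star U * U)) * star Q := by
          simp only [mul_assoc]
      _ = _ := by rw [hUU, one_mul, mul_one]
  rw [hconj, hVQ, ← sub_mul, ← mul_sub, trNorm_mul_unitary (Unitary.star_mem hQu), trNorm_unitary_mul hQu,
    Matrix.diagonal_sub, trNorm_diagonal]

/-- If the averages of every character over two families of points of the circle agree in the
limit, then so do the averages of every continuous function. -/
theorem tendsto_average_sub_of_fourier {α : Type*} {l : Filter α} {n : α → ℕ}
    (hn : ∀ k, 0 < n k) (x y : ∀ k, Fin (n k) → UnitAddCircle)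
    (h : ∀ m : ℤ, Tendsto (fun k => (∑ i, fourier m (x k i)) / (n k : ℂ) -
      (∑ i, fourier m (y k i)) / (n k : ℂ)) l (nhds 0)) (f : C(UnitAddCircle, ℂ)) :
    Tendsto (fun k => (∑ i, f (x k i)) / (n k : ℂ) - (∑ i, f (y k i)) / (n k : ℂ)) l (nhds 0) := by
  have hspan : ∀ g ∈ Submodule.span ℂ (Set.range (@fourier 1)),
      Tendsto (fun k => (∑ i, g (x k i)) / (n k : ℂ) - (∑ i, g (y k i)) / (n k : ℂ)) l
        (nhds 0) := by
    intro g hg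
    induction hg using Submodule.span_induction with
    | mem g hg => obtain ⟨m, rfl⟩ := hg; exact h m
    | zero => simpa using tendsto_const_nhds
    | add g₁ g₂ _ _ h₁ h₂ =>
      refine (by simpa using h₁.add h₂ : Tendsto _ l (nhds (0 : ℂ))).congr fun k => ?_
      simp only [ContinuousMap.add_apply, Finset.sum_add_distrib]
      ring
    | smul c g _ h₁ =>
      refine (by simpa using h₁.const_mul c : Tendsto _ l (nhds (0 : ℂ))).congr fun k => ?_
      simp only [ContinuousMap.smul_apply, smul_eq_mul, ← Finset.mul_sum]
      ring
  have havg : ∀ (g : C(UnitAddCircle, ℂ)) (k) (z : Fin (n k) → UnitAddCircle),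
      ‖(∑ i, g (z i)) / (n k : ℂ)‖ ≤ ‖g‖ := by
    intro g k z
    rw [norm_div, Complex.norm_natCast, div_le_iff₀ (Nat.cast_pos.2 (hn k))]
    refine (norm_sum_le_of_le _ fun i _ => g.norm_coe_le_norm (z i)).trans ?_
    simp [mul_comm]
  rw [Metric.tendsto_nhds]
  intro ε hε
  have hf : f ∈ closure (Submodule.span ℂ (Set.range (@fourier 1)) : Set C(UnitAddCircle, ℂ)) := by
    rw [← Submodule.topologicalClosure_coe, span_fourier_closure_eq_top]
    trivial
  obtain ⟨g, hg, hfg⟩ := Metric.mem_closure_iff.1 hf (ε / 4) (by positivity)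
  filter_upwards [Metric.tendsto_nhds.1 (hspan g hg) (ε / 4) (by positivity)] with k hk
  rw [dist_zero_right] at hk ⊢
  rw [dist_eq_norm] at hfg
  have h1 := havg (f - g) k (x k)
  have h2 := havg (f - g) k (y k)
  have heq : (∑ i, f (x k i)) / (n k : ℂ) - (∑ i, f (y k i)) / (n k : ℂ) =
      (∑ i, (f - g) (x k i)) / (n k : ℂ) - (∑ i, (f - g) (y k i)) / (n k : ℂ) +
        ((∑ i, g (x k i)) / (n k : ℂ) - (∑ i, g (y k i)) / (n k : ℂ)) := by
    simp only [ContinuousMap.sub_apply, Finset.sum_sub_distrib]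
    ring
  rw [heq]
  refine (norm_add_le _ _).trans_lt ?_
  have h3 := norm_sub_le ((∑ i, (f - g) (x k i)) / (n k : ℂ)) ((∑ i, (f - g) (y k i)) / (n k : ℂ))
  linarith

/-- Families of points of the circle with asymptotically equal character averages can be matched
with asymptotically vanishing mean square distance. -/
theorem exists_perm_tendsto_of_fourier {α : Type*} {l : Filter α} {n : α → ℕ}
    (hn : ∀ k, 0 < n k) (x y : ∀ k, Fin (n k) → UnitAddCircle)
    (h : ∀ m : ℤ, Tendsto (fun k => (∑ i, fourier m (x k i)) / (n k : ℂ) -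
      (∑ i, fourier m (y k i)) / (n k : ℂ)) l (nhds 0)) :
    ∃ σ : ∀ k, Equiv.Perm (Fin (n k)),
      Tendsto (fun k => Real.sqrt
        ((∑ i, ‖fourier 1 (x k i) - fourier 1 (y k (σ k i))‖ ^ 2) / n k)) l (nhds 0) := by
  choose σ hσ using fun k => Finite.exists_min fun σ : Equiv.Perm (Fin (n k)) =>
    ∑ i, ‖fourier 1 (x k i) - fourier 1 (y k (σ i))‖ ^ 2
  refine ⟨σ, ?_⟩
  rw [Metric.tendsto_nhds]
  intro ε hε
  obtain ⟨s, φ, hφ0, hφ1, hφ⟩ := exists_partition_of_unity_small_image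
    (fourier (T := 1) 1).continuous (half_pos hε)
  have hφt : Tendsto (fun k => 4 * ∑ j, |(∑ i, φ j (x k i)) / n k - (∑ i, φ j (y k i)) / n k|) l
      (nhds 0) := by
    have : Tendsto (fun k => 4 * ∑ j, |(∑ i, φ j (x k i)) / n k - (∑ i, φ j (y k i)) / n k|) l
        (nhds (4 * ∑ j : s, 0)) := by
      refine (tendsto_finsetSum _ fun j _ => ?_).const_mul 4
      have := (tendsto_average_sub_of_fourier hn x y h
        ⟨fun z => (φ j z : ℂ), by fun_prop⟩).norm
      rw [norm_zero] at this
      refine this.congr fun k => ?_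
      rw [← Real.norm_eq_abs, ← Complex.norm_real]
      push_cast
      rfl
    simpa using this
  filter_upwards [Metric.tendsto_nhds.1 hφt (3 / 4 * ε ^ 2) (by positivity)] with k hk
  have hnk : (0 : ℝ) < n k := Nat.cast_pos.2 (hn k)
  rw [dist_zero_right, Real.norm_eq_abs] at hk ⊢
  rw [abs_of_nonneg (Real.sqrt_nonneg _), Real.sqrt_lt' hε, div_lt_iff₀ hnk]
  have hnorm : ∀ z : UnitAddCircle, ‖fourier 1 z‖ = 1 := fun z => Circle.norm_coe _
  obtain ⟨τ, hτ⟩ := exists_perm_sum_cost_le (fun j z => φ j z) hφ0 hφ1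
    (fun a b : UnitAddCircle => ‖fourier 1 a - fourier 1 b‖ ^ 2) (B := 4) (ε := (ε / 2) ^ 2)
    (fun a b => by
      have := norm_sub_le (fourier 1 a) (fourier 1 b)
      rw [hnorm, hnorm] at this
      nlinarith [norm_nonneg (fourier 1 a - fourier 1 b)])
    (by norm_num) (by positivity)
    (fun j a b hab => pow_le_pow_left₀ (norm_nonneg _) (hφ j a b hab) 2) (x k) (y k)
  have hsum : ∑ j, |∑ i, φ j (x k i) - ∑ i, φ j (y k i)| =
      (∑ j, |(∑ i, φ j (x k i)) / n k - (∑ i, φ j (y k i)) / n k|) * n k := by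
    rw [Finset.sum_mul]
    refine Finset.sum_congr rfl fun j _ => ?_
    rw [← sub_div, abs_div, abs_of_pos hnk, div_mul_cancel₀ _ hnk.ne']
  rw [hsum, Fintype.card_fin] at hτ
  have := hσ k τ
  have hk' := mul_lt_mul_of_pos_right ((le_abs_self _).trans_lt hk) hnk
  nlinarith

/-- Let `ω` be a free ultrafilter on `ℕ`, `(n k)` positive integers tending
to `∞`, and `u k, v k ∈ M_{n k}(ℂ)` unitary. The following are equivalent: (a) there are
unitary `w k` with `‖w k * u k * (w k)* − v k‖₂ → 0` along `ω`; (b) for every `m ∈ ℤ`,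
`Tr((u k)^m) − Tr((v k)^m) → 0` along `ω`. -/
theorem conjugate_in_ultraproduct_iff_traces_of_powers (ω : Ultrafilter ℕ)
    (hω : (ω : Filter ℕ) ≤ Filter.cofinite)
    (n : ℕ → ℕ) (hn : ∀ k, 0 < n k) (hn' : Tendsto n atTop atTop)
    (u v : ∀ k, Matrix (Fin (n k)) (Fin (n k)) ℂ)
    (hu : ∀ k, u k ∈ Matrix.unitaryGroup (Fin (n k)) ℂ)
    (hv : ∀ k, v k ∈ Matrix.unitaryGroup (Fin (n k)) ℂ) :
    (∃ w : ∀ k, Matrix (Fin (n k)) (Fin (n k)) ℂ,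
        (∀ k, w k ∈ Matrix.unitaryGroup (Fin (n k)) ℂ) ∧
        Tendsto (fun k => trNorm (w k * u k * star (w k) - v k)) (ω : Filter ℕ) (nhds 0)) ↔
      ∀ m : ℤ,
        Tendsto (fun k => nTr (u k ^ m) - nTr (v k ^ m)) (ω : Filter ℕ) (nhds 0) := by
  constructor
  · rintro ⟨w, hw, hlim⟩ m
    refine squeeze_zero_norm
      (fun k => norm_nTr_zpow_sub_le (hn k) (hu k) (hv k) (hw k) m) ?_
    simpa using hlim.const_mul (m.natAbs : ℝ)
  · intro h
    choose U hU x hx using fun k => Matrix.exists_diagonalization_of_mem_unitaryGroup (hu k)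
    choose V hV y hy using fun k => Matrix.exists_diagonalization_of_mem_unitaryGroup (hv k)
    obtain ⟨σ, hσ⟩ := exists_perm_tendsto_of_fourier hn x y fun m => (h m).congr fun k => by
      rw [hx k, hy k, nTr_zpow_conj_diagonal_fourier (hU k) (x k) (hx k ▸ hu k),
        nTr_zpow_conj_diagonal_fourier (hV k) (y k) (hy k ▸ hv k)]
    choose w hw hwσ using fun k => exists_unitary_trNorm_conj_sub_eq (hU k) (hV k)
      (fun i => fourier 1 (x k i)) (fun i => fourier 1 (y k i)) (σ k)
    refine ⟨w, hw, hσ.congr fun k => ?_⟩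
    rw [← hwσ k, ← hx k, ← hy k]
end

section
/- Let ω be a free ultrafilter on ℕ, let (n_k) be a sequence of positive integers with n_k → ∞, and let p_k, q_k be permutations of {1,…,n_k} with permutation matrices P_k, Q_k ∈ M_{n_k}(ℂ). Then there exists a sequence of permutations s_k of {1,…,n_k}, with permutation matrices S_k, such that ‖S_k P_k S_k^{-1} − Q_k‖₂ converges to 0 along ω, if and only if for every i ∈ ℕ* the sequences cyc_i(p_k) and cyc_i(q_k) converge to the same limit along ω. -/
open Filter

/-- The permutation matrix of `p`: `P i j = 1` if `i = p j`, else `0`. -/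
def permMatrix {n : ℕ} (p : Equiv.Perm (Fin n)) : Matrix (Fin n) (Fin n) ℂ :=
  Matrix.of fun i j => if i = p j then 1 else 0

/-- `cyc i p` : the number of points lying in cycles of length `i` of `p`, divided by `n`. -/
noncomputable def cyc {n : ℕ} (p : Equiv.Perm (Fin n)) (i : ℕ) : ℝ :=
  ((Finset.univ.filter fun x : Fin n => Function.minimalPeriod (⇑p) x = i).card : ℝ) / n

namespace ElekSzabo

open Equiv

/-- The number of points of period `k` under `p`. -/
noncomputable def periodCount {α : Type*} [Fintype α] (p : Perm α) (k : ℕ) : ℕ :=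
  (Finset.univ.filter fun x : α => Function.minimalPeriod (⇑p) x = k).card

theorem minimalPeriod_of_semiconj {α β : Type*} {φ : α → β} (hφ : Function.Injective φ)
    {f : α → α} {g : β → β} (h : Function.Semiconj φ f g) (x : α) :
    Function.minimalPeriod g (φ x) = Function.minimalPeriod f x := by
  rw [Function.minimalPeriod_eq_minimalPeriod_iff]
  intro n
  unfold Function.IsPeriodicPt Function.IsFixedPt
  rw [← (h.iterate_right n).eq, hφ.eq_iff]

theorem periodCount_permCongr {α β : Type*} [Fintype α] [Fintype β] (e : α ≃ β) (p : Perm α)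
    (k : ℕ) : periodCount (e.permCongr p) k = periodCount p k := by
  symm
  refine Finset.card_equiv e fun x => ?_
  have h : Function.minimalPeriod (e.permCongr p) (e x) = Function.minimalPeriod p x :=
    minimalPeriod_of_semiconj e.injective (fun y => by simp [Equiv.permCongr_apply]) x
  simp [h]

theorem periodCount_conj {α : Type*} [Fintype α] (s p : Perm α) (k : ℕ) :
    periodCount (s * p * s⁻¹) k = periodCount p k :=
  periodCount_permCongr s p k

theorem periodCount_sumCongr {α β : Type*} [Fintype α] [Fintype β] (p : Perm α) (q : Perm β)
    (k : ℕ) : periodCount (Perm.sumCongr p q) k = periodCount p k + periodCount q k := by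
  have hl (x : α) : Function.minimalPeriod (Perm.sumCongr p q) (Sum.inl x) =
      Function.minimalPeriod p x :=
    minimalPeriod_of_semiconj Sum.inl_injective (fun y => by simp) x
  have hr (x : β) : Function.minimalPeriod (Perm.sumCongr p q) (Sum.inr x) =
      Function.minimalPeriod q x :=
    minimalPeriod_of_semiconj Sum.inr_injective (fun y => by simp) x
  simp only [periodCount, Finset.card_filter, Fintype.sum_sum_type, hl, hr]

open scoped Fin.CommRing in
theorem periodCount_finRotate {a : ℕ} (ha : 0 < a) (k : ℕ) :
    periodCount (finRotate a) k = if k = a then a else 0 := by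
  obtain ⟨a, rfl⟩ := Nat.exists_eq_succ_of_ne_zero ha.ne'
  have hit (j : ℕ) (x : Fin (a + 1)) : (finRotate (a + 1))^[j] x = x + (j : Fin (a + 1)) := by
    induction j with
    | zero => simp
    | succ j ih => rw [Function.iterate_succ_apply', ih, finRotate_apply]; push_cast; ring
  have hp (j : ℕ) (x : Fin (a + 1)) :
      Function.IsPeriodicPt (finRotate (a + 1)) j x ↔ a + 1 ∣ j := by
    unfold Function.IsPeriodicPt Function.IsFixedPt
    rw [hit, add_eq_left, Fin.natCast_eq_zero]
  have hm (x : Fin (a + 1)) : Function.minimalPeriod (finRotate (a + 1)) x = a + 1 :=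
    Nat.dvd_antisymm (((hp _ x).2 dvd_rfl).minimalPeriod_dvd)
      ((hp _ x).1 (Function.isPeriodicPt_minimalPeriod _ _))
  unfold periodCount
  rcases eq_or_ne k (a + 1) with rfl | h
  · simp [hm]
  · simp [hm, h, h.symm]

theorem cycleType_permCongr {α β : Type*} [Fintype α] [Fintype β] [DecidableEq α] [DecidableEq β]
    (e : α ≃ β) (p : Perm α) : (e.permCongr p).cycleType = p.cycleType := by
  have h : e.permCongr p =
      p.extendDomain (e.trans (Equiv.subtypeUnivEquiv fun _ : β => trivial).symm) := by
    ext x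
    obtain ⟨y, rfl⟩ := e.surjective x
    have := p.extendDomain_apply_image
      (e.trans (Equiv.subtypeUnivEquiv fun _ : β => trivial).symm) y
    simpa using this.symm
  rw [h, Perm.cycleType_extendDomain]

theorem cycleType_sumCongr {α β : Type*} [Fintype α] [Fintype β] [DecidableEq α] [DecidableEq β]
    (p : Perm α) (q : Perm β) :
    (Perm.sumCongr p q).cycleType = p.cycleType + q.cycleType := by
  have hl : Perm.sumCongr p (1 : Perm β) =
      p.extendDomain (Equiv.ofInjective (Sum.inl : α → α ⊕ β) Sum.inl_injective) := by
    ext x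
    rcases x with x | x
    · exact (p.extendDomain_apply_image (Equiv.ofInjective _ Sum.inl_injective) x).symm
    · rw [Perm.extendDomain_apply_not_subtype _ _ (by simp)]; simp
  have hr : Perm.sumCongr (1 : Perm α) q =
      q.extendDomain (Equiv.ofInjective (Sum.inr : β → α ⊕ β) Sum.inr_injective) := by
    ext x
    rcases x with x | x
    · rw [Perm.extendDomain_apply_not_subtype _ _ (by simp)]; simp
    · exact (q.extendDomain_apply_image (Equiv.ofInjective _ Sum.inr_injective) x).symm
  have hmul : Perm.sumCongr p q = Perm.sumCongr p 1 * Perm.sumCongr 1 q := by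
    simp [Perm.sumCongr_mul]
  have hdisj : (Perm.sumCongr p (1 : Perm β)).Disjoint (Perm.sumCongr 1 q) := by
    rintro (x | x) <;> simp
  rw [hmul, hdisj.cycleType_mul, hl, hr, Perm.cycleType_extendDomain, Perm.cycleType_extendDomain]

theorem hammingDist_permCongr {α β : Type*} [Fintype α] [Fintype β] [DecidableEq α]
    [DecidableEq β] (e : α ≃ β) (p q : Perm α) :
    hammingDist (e.permCongr p) (e.permCongr q) = hammingDist p q := by
  symm
  unfold hammingDist
  refine Finset.card_equiv e fun x => ?_
  simp

theorem hammingDist_conj {α : Type*} [Fintype α] [DecidableEq α] (s p q : Perm α) :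
    hammingDist ⇑(s * p * s⁻¹) ⇑(s * q * s⁻¹) = hammingDist p q :=
  hammingDist_permCongr s p q

theorem hammingDist_sumCongr {α β : Type*} [Fintype α] [Fintype β] [DecidableEq α]
    [DecidableEq β] (p p' : Perm α) (q q' : Perm β) :
    hammingDist (Perm.sumCongr p q) (Perm.sumCongr p' q') =
      hammingDist p p' + hammingDist q q' := by
  simp [hammingDist, Finset.card_filter, Fintype.sum_sum_type]

theorem val_finRotate_of_lt {n : ℕ} (x : Fin n) (h : (x : ℕ) + 1 < n) :
    (finRotate n x : ℕ) = x + 1 := by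
  obtain ⟨n, rfl⟩ := Nat.exists_eq_succ_of_ne_zero (by omega : n ≠ 0)
  exact coe_finRotate_of_ne_last (by simp only [ne_eq, Fin.ext_iff, Fin.val_last]; omega)

/-- Two consecutive rotations differ from the rotation of the union in at most two points. -/
theorem hammingDist_sumCongr_finRotate_le (a b : ℕ) :
    hammingDist (finSumFinEquiv.permCongr (Perm.sumCongr (finRotate a) (finRotate b)))
      (finRotate (a + b)) ≤ 2 := by
  unfold hammingDist
  have hsub : (Finset.univ.filter fun x : Fin (a + b) =>
      finSumFinEquiv.permCongr (Perm.sumCongr (finRotate a) (finRotate b)) x ≠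
        finRotate (a + b) x).map Fin.valEmbedding ⊆ {a - 1, a + b - 1} := by
    intro v hv
    simp only [Finset.mem_map, Finset.mem_filter, Finset.mem_univ, true_and] at hv
    obtain ⟨x, hx, rfl⟩ := hv
    obtain ⟨y, rfl⟩ := finSumFinEquiv.surjective x
    by_contra hne
    simp only [Fin.valEmbedding_apply, Finset.mem_insert, Finset.mem_singleton, not_or] at hne
    apply hx
    rcases y with ⟨y, hy⟩ | ⟨y, hy⟩
    · simp only [finSumFinEquiv_apply_left, Fin.val_castAdd] at hne
      ext
      rw [Equiv.permCongr_apply, Equiv.symm_apply_apply, Perm.sumCongr_apply, Sum.map_inl,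
        finSumFinEquiv_apply_left, finSumFinEquiv_apply_left, Fin.val_castAdd,
        val_finRotate_of_lt _ (by simp only; omega),
        val_finRotate_of_lt _ (by simp only [Fin.val_castAdd]; omega), Fin.val_castAdd]
    · simp only [finSumFinEquiv_apply_right, Fin.val_natAdd] at hne
      ext
      rw [Equiv.permCongr_apply, Equiv.symm_apply_apply, Perm.sumCongr_apply, Sum.map_inr,
        finSumFinEquiv_apply_right, finSumFinEquiv_apply_right, Fin.val_natAdd,
        val_finRotate_of_lt _ (by simp only; omega),
        val_finRotate_of_lt _ (by simp only [Fin.val_natAdd]; omega), Fin.val_natAdd, add_assoc]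
  have := Finset.card_le_card hsub
  rw [Finset.card_map] at this
  exact this.trans Finset.card_le_two

/-- Every multiset of cycle lengths is realized by a permutation close to the full rotation. -/
theorem exists_perm_of_multiset (M : Multiset ℕ) (hM : ∀ a ∈ M, 0 < a) (n : ℕ)
    (hn : M.sum = n) :
    ∃ u : Perm (Fin n), u.cycleType = M.filter (2 ≤ ·) ∧
      (∀ k, periodCount u k = k * M.count k) ∧
      hammingDist u (finRotate n) ≤ 2 * M.card := by
  induction M using Multiset.induction_on generalizing n with
  | empty =>
    obtain rfl : n = 0 := hn.symm
    exact ⟨1, by simp, by simp [periodCount], by simp [hammingDist]⟩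
  | cons a M ih =>
    rw [Multiset.sum_cons] at hn
    subst hn
    obtain ⟨u, hu1, hu2, hu3⟩ := ih (fun b hb => hM b (Multiset.mem_cons_of_mem hb)) _ rfl
    have ha : 0 < a := hM a (Multiset.mem_cons_self a M)
    refine ⟨finSumFinEquiv.permCongr (Perm.sumCongr (finRotate a) u), ?_, fun k => ?_, ?_⟩
    · rw [cycleType_permCongr, cycleType_sumCongr, hu1]
      rcases (by omega : a = 1 ∨ 2 ≤ a) with rfl | h2
      · rw [Subsingleton.elim (finRotate 1) 1, Perm.cycleType_one]
        simp
      · rw [Multiset.filter_cons_of_pos _ h2, cycleType_finRotate_of_le h2,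
          Multiset.singleton_add]
    · rw [periodCount_permCongr, periodCount_sumCongr, hu2, periodCount_finRotate ha,
        Multiset.count_cons]
      split_ifs with h
      · subst h; ring
      · ring
    · have h1 := hammingDist_triangle (finSumFinEquiv.permCongr (Perm.sumCongr (finRotate a) u))
        (finSumFinEquiv.permCongr (Perm.sumCongr (finRotate a) (finRotate M.sum)))
        (finRotate (a + M.sum))
      have h2 := hammingDist_sumCongr_finRotate_le a M.sum
      rw [hammingDist_permCongr, hammingDist_sumCongr, hammingDist_self] at h1
      rw [Multiset.card_cons]
      omega

/-- If `M` and `N` are the multisets of cycle lengths of `p` and `q`, then `p` has a conjugate that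
differs from `q` in at most `2 (|M - N| + |N - M|)` points. -/
theorem exists_conj_hammingDist_le {n : ℕ} (p q : Perm (Fin n)) :
    ∃ M N : Multiset ℕ, (∀ k, periodCount p k = k * M.count k) ∧
      (∀ k, periodCount q k = k * N.count k) ∧ (∀ a ∈ M, 0 < a) ∧ (∀ a ∈ N, 0 < a) ∧
      M.sum = n ∧ N.sum = n ∧
      ∃ s : Perm (Fin n), hammingDist ⇑(s * p * s⁻¹) q ≤ 2 * ((M - N).card + (N - M).card) := by
  let M := p.partition.parts
  let N := q.partition.parts
  have hMpos : ∀ a ∈ M, 0 < a := fun a => p.partition.parts_pos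
  have hNpos : ∀ a ∈ N, 0 < a := fun a => q.partition.parts_pos
  have hMsum : M.sum = n := p.partition.parts_sum.trans (Fintype.card_fin n)
  have hNsum : N.sum = n := q.partition.parts_sum.trans (Fintype.card_fin n)
  have hMR : M ∩ N + (M - N) = M := by
    ext k; simp only [Multiset.count_add, Multiset.count_inter, Multiset.count_sub]; omega
  have hNR : M ∩ N + (N - M) = N := by
    ext k; simp only [Multiset.count_add, Multiset.count_inter, Multiset.count_sub]; omega
  obtain ⟨r, hr1, hr2, -⟩ := exists_perm_of_multiset (M ∩ N)
    (fun a ha => hMpos a (Multiset.mem_of_le Multiset.inter_le_left ha)) _ rfl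
  obtain ⟨u, hu1, hu2, hu3⟩ := exists_perm_of_multiset (M - N)
    (fun a ha => hMpos a (Multiset.mem_of_le tsub_le_self ha)) _ rfl
  have hsumeq : (N - M).sum = (M - N).sum := by
    have h1 := congrArg Multiset.sum hMR
    have h2 := congrArg Multiset.sum hNR
    rw [Multiset.sum_add] at h1 h2
    omega
  obtain ⟨v, hv1, hv2, hv3⟩ := exists_perm_of_multiset (N - M)
    (fun a ha => hNpos a (Multiset.mem_of_le tsub_le_self ha)) _ hsumeq
  have hsum : (M ∩ N).sum + (M - N).sum = n := by rw [← Multiset.sum_add, hMR, hMsum]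
  let e : Fin (M ∩ N).sum ⊕ Fin (M - N).sum ≃ Fin n := finSumFinEquiv.trans (finCongr hsum)
  let p' : Perm (Fin n) := e.permCongr (Perm.sumCongr r u)
  let q' : Perm (Fin n) := e.permCongr (Perm.sumCongr r v)
  have hp' : IsConj p p' := by
    rw [Perm.isConj_iff_cycleType_eq, cycleType_permCongr, cycleType_sumCongr, hr1, hu1,
      ← Multiset.filter_add, hMR, Perm.filter_parts_partition_eq_cycleType]
  have hq' : IsConj q q' := by
    rw [Perm.isConj_iff_cycleType_eq, cycleType_permCongr, cycleType_sumCongr, hr1, hv1,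
      ← Multiset.filter_add, hNR, Perm.filter_parts_partition_eq_cycleType]
  have hd : hammingDist p' q' ≤ 2 * ((M - N).card + (N - M).card) := by
    have h1 := hammingDist_triangle u (finRotate (M - N).sum) v
    rw [hammingDist_comm ⇑(finRotate _) ⇑v] at h1
    rw [hammingDist_permCongr, hammingDist_sumCongr, hammingDist_self]
    omega
  obtain ⟨c, hc⟩ := isConj_iff.1 hp'
  obtain ⟨d, hd'⟩ := isConj_iff.1 hq'
  refine ⟨M, N, fun k => ?_, fun k => ?_, hMpos, hNpos, hMsum, hNsum, d⁻¹ * c, ?_⟩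
  · rw [← periodCount_conj c p, hc, periodCount_permCongr, periodCount_sumCongr, hr2, hu2,
      ← mul_add, ← Multiset.count_add, hMR]
  · rw [← periodCount_conj d q, hd', periodCount_permCongr, periodCount_sumCongr, hr2, hv2,
      ← mul_add, ← Multiset.count_add, hNR]
  · rw [← hammingDist_conj d]
    have h1 : d * (d⁻¹ * c * p * (d⁻¹ * c)⁻¹) * d⁻¹ = p' := by rw [← hc]; group
    rw [h1, hd']
    exact hd

theorem mul_card_multiset_sub_le {n m : ℕ} {M N : Multiset ℕ} (hM : ∀ a ∈ M, 0 < a) (hn : M.sum = n)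
    (x y : ℕ → ℕ) (hx : ∀ k, x k = k * M.count k) (hy : ∀ k, y k = k * N.count k) :
    (m * (M - N).card : ℝ) ≤ m * ∑ k ∈ Finset.Icc 1 m, |(x k : ℝ) - y k| + n := by
  have hsplit := congrArg Multiset.card (Multiset.filter_add_not (fun k => k ≤ m) (M - N))
  rw [Multiset.card_add] at hsplit
  have hpos : ∀ a ∈ M - N, 0 < a := fun a ha => hM a (Multiset.mem_of_le tsub_le_self ha)
  have hshort : (((M - N).filter (fun k => k ≤ m)).card : ℝ) ≤
      ∑ k ∈ Finset.Icc 1 m, |(x k : ℝ) - y k| := by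
    rw [← Multiset.sum_count_eq_card (s := Finset.Icc 1 m) (fun a ha => by
      rw [Multiset.mem_filter] at ha
      exact Finset.mem_Icc.2 ⟨hpos a ha.1, ha.2⟩), Nat.cast_sum]
    refine Finset.sum_le_sum fun k hk => ?_
    rw [Finset.mem_Icc] at hk
    rw [Multiset.count_filter_of_pos (p := fun k => k ≤ m) hk.2, Multiset.count_sub, hx, hy]
    have hk1 : (1 : ℝ) ≤ k := by exact_mod_cast hk.1
    push_cast
    rw [← mul_sub, abs_mul, Nat.abs_cast]
    refine le_trans ?_ (le_mul_of_one_le_left (abs_nonneg _) hk1)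
    rcases le_total (M.count k) (N.count k) with h | h
    · rw [Nat.sub_eq_zero_of_le h]; simp
    · rw [Nat.cast_sub h]; exact le_abs_self _
  have hlong : m * ((M - N).filter (fun k => ¬ k ≤ m)).card ≤ n := by
    have h1 : ((M - N).filter (fun k => ¬ k ≤ m)).card • m ≤
        ((M - N).filter (fun k => ¬ k ≤ m)).sum :=
      Multiset.card_nsmul_le_sum fun a ha => (not_le.1 (Multiset.mem_filter.1 ha).2).le
    have h2 : ((M - N).filter (fun k => ¬ k ≤ m)).sum ≤ M.sum := by
      have hle : (M - N).filter (fun k => ¬ k ≤ m) ≤ M :=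
        (Multiset.filter_le _ _).trans tsub_le_self
      obtain ⟨T, hT⟩ := Multiset.le_iff_exists_add.1 hle
      conv_rhs => rw [hT, Multiset.sum_add]
      exact Nat.le_add_right _ _
    rw [smul_eq_mul] at h1
    rw [mul_comm]
    omega
  have hlong' : (m : ℝ) * ((M - N).filter (fun k => ¬ k ≤ m)).card ≤ n := by
    exact_mod_cast hlong
  rw [← hsplit, Nat.cast_add, mul_add]
  gcongr

theorem cyc_eq {n : ℕ} (p : Perm (Fin n)) (i : ℕ) : cyc p i = (periodCount p i : ℝ) / n := rfl

/-- The quantitative form of the criterion: `p` has a conjugate which is close to `q`. -/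
theorem exists_conj_hammingDist_div_le {n m : ℕ} (hn : 0 < n) (hm : 0 < m)
    (p q : Perm (Fin n)) :
    ∃ s : Perm (Fin n), (hammingDist ⇑(s * p * s⁻¹) q : ℝ) / n ≤
      4 * ∑ k ∈ Finset.Icc 1 m, |cyc p k - cyc q k| + 4 / m := by
  obtain ⟨M, N, hp, hq, hM, hN, hMs, hNs, s, hs⟩ := exists_conj_hammingDist_le p q
  have h1 := mul_card_multiset_sub_le (m := m) hM hMs _ _ hp hq
  have h2 := mul_card_multiset_sub_le (m := m) hN hNs _ _ hq hp
  simp only [abs_sub_comm (periodCount q _ : ℝ)] at h2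
  have h3 : (hammingDist ⇑(s * p * s⁻¹) q : ℝ) ≤ 2 * ((M - N).card + (N - M).card) := by
    exact_mod_cast hs
  have hn' : (0 : ℝ) < n := by exact_mod_cast hn
  have hm' : (0 : ℝ) < m := by exact_mod_cast hm
  have h4 : ∑ k ∈ Finset.Icc 1 m, |cyc p k - cyc q k| =
      (∑ k ∈ Finset.Icc 1 m, |(periodCount p k : ℝ) - periodCount q k|) / n := by
    rw [Finset.sum_div]
    refine Finset.sum_congr rfl fun k _ => ?_
    rw [cyc_eq, cyc_eq, ← sub_div, abs_div, Nat.abs_cast]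
  refine ⟨s, ?_⟩
  rw [h4]
  set S := ∑ k ∈ Finset.Icc 1 m, |(periodCount p k : ℝ) - periodCount q k|
  have h5 : (m : ℝ) * hammingDist ⇑(s * p * s⁻¹) q ≤ 4 * (m * S) + 4 * n := by
    nlinarith
  have h6 : 4 * (S / n) + 4 / m = (4 * (m * S) + 4 * n) / (m * n) := by
    field_simp
  rw [h6, div_le_div_iff₀ hn' (by positivity)]
  nlinarith

theorem periodCount_le_add {α : Type*} [Fintype α] [DecidableEq α] (p q : Perm α) {i : ℕ}
    (hi : 0 < i) : periodCount p i ≤ periodCount q i + i * hammingDist p q := by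
  let D : Finset α := Finset.univ.filter fun x => p x ≠ q x
  let B : Finset α := (Finset.range i).biUnion fun j =>
    D.map ((p ^ j)⁻¹ : Perm α).toEmbedding
  have hB : B.card ≤ i * D.card := by
    refine Finset.card_biUnion_le.trans ?_
    simp
  have hsub : (Finset.univ.filter fun x : α => Function.minimalPeriod p x = i) ⊆
      (Finset.univ.filter fun x : α => Function.minimalPeriod q x = i) ∪ B := by
    intro x hx
    rw [Finset.mem_filter] at hx
    rw [Finset.mem_union, Finset.mem_filter]
    by_contra! hcon
    have hgood : ∀ j < i, p (p^[j] x) = q (p^[j] x) := by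
      intro j hj
      by_contra hne
      refine hcon.2 (Finset.mem_biUnion.2 ⟨j, Finset.mem_range.2 hj, Finset.mem_map.2
        ⟨p^[j] x, by simpa [D] using hne, ?_⟩⟩)
      rw [← Perm.coe_pow]
      simp
    have hit : ∀ j ≤ i, q^[j] x = p^[j] x := by
      intro j
      induction j with
      | zero => simp
      | succ j ih =>
        intro hj
        rw [Function.iterate_succ_apply', Function.iterate_succ_apply', ih (by omega),
          hgood j (by omega)]
    have hper : Function.IsPeriodicPt q i x := by
      unfold Function.IsPeriodicPt Function.IsFixedPt
      rw [hit i le_rfl, ← hx.2]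
      exact Function.isPeriodicPt_minimalPeriod _ _
    have hle := hper.minimalPeriod_le hi
    have hpos := hper.minimalPeriod_pos hi
    have hper' : Function.IsPeriodicPt p (Function.minimalPeriod q x) x := by
      unfold Function.IsPeriodicPt Function.IsFixedPt
      rw [← hit _ hle]
      exact Function.isPeriodicPt_minimalPeriod _ _
    have hge := hper'.minimalPeriod_le hpos
    exact hcon.1 (Finset.mem_univ _) (by omega)
  exact (Finset.card_le_card hsub).trans ((Finset.card_union_le _ _).trans
    (Nat.add_le_add_left hB _))

theorem abs_cyc_sub_le {n : ℕ} (p q : Perm (Fin n)) {i : ℕ} (hi : 0 < i) :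
    |cyc p i - cyc q i| ≤ i * ((hammingDist p q : ℝ) / n) := by
  have h1 : (periodCount p i : ℝ) ≤ periodCount q i + i * hammingDist p q := by
    exact_mod_cast periodCount_le_add p q hi
  have h2 : (periodCount q i : ℝ) ≤ periodCount p i + i * hammingDist p q := by
    rw [hammingDist_comm]
    exact_mod_cast periodCount_le_add q p hi
  rw [cyc_eq, cyc_eq, ← sub_div, abs_div, Nat.abs_cast, ← mul_div_assoc]
  gcongr
  exact abs_sub_le_iff.2 ⟨by linarith, by linarith⟩

theorem cyc_conj {n : ℕ} (s p : Perm (Fin n)) (i : ℕ) : cyc (s * p * s⁻¹) i = cyc p i := by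
  rw [cyc_eq, cyc_eq, periodCount_conj]

theorem cyc_mem_Icc {n : ℕ} (p : Perm (Fin n)) (i : ℕ) : cyc p i ∈ Set.Icc (0 : ℝ) 1 := by
  refine ⟨by unfold cyc; positivity, div_le_one_of_le₀ ?_ (Nat.cast_nonneg n)⟩
  exact_mod_cast (Finset.card_le_univ _).trans (Fintype.card_fin n).le

theorem permMatrix_mul {n : ℕ} (p q : Perm (Fin n)) :
    permMatrix p * permMatrix q = permMatrix (p * q) := by
  ext i j
  simp [permMatrix, Matrix.mul_apply]
  rfl

theorem permMatrix_inv {n : ℕ} (p : Perm (Fin n)) : (permMatrix p)⁻¹ = permMatrix p⁻¹ := by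
  refine Matrix.inv_eq_right_inv ?_
  rw [permMatrix_mul, mul_inv_cancel]
  ext i j
  simp [permMatrix, Matrix.one_apply]
  rfl

theorem trNorm_permMatrix_sub {n : ℕ} (p q : Perm (Fin n)) :
    trNorm (permMatrix p - permMatrix q) = √(2 * ((hammingDist p q : ℝ) / n)) := by
  unfold trNorm
  congr 1
  rw [← mul_div_assoc, Finset.sum_comm, hammingDist, Finset.card_filter, Nat.cast_sum,
    Finset.mul_sum]
  congr 1
  refine Finset.sum_congr rfl fun j _ => ?_
  rcases eq_or_ne (p j) (q j) with h | h
  · simp [permMatrix, h]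
  · have hterm (i : Fin n) : Complex.normSq ((permMatrix p - permMatrix q) i j) =
        (if i = p j then 1 else 0) + if i = q j then 1 else 0 := by
      by_cases h1 : i = p j
      · have h2 : i ≠ q j := fun h2 => h (h1.symm.trans h2)
        simp [permMatrix, h1, h]
      · by_cases h2 : i = q j
        · simp [permMatrix, h2, h.symm]
        · simp [permMatrix, h1, h2]
    simp only [hterm, Finset.sum_add_distrib, Finset.sum_ite_eq', Finset.mem_univ, if_true]
    simp [h]
    norm_num

theorem trNorm_conj_sub {n : ℕ} (s p q : Perm (Fin n)) :
    trNorm (permMatrix s * permMatrix p * (permMatrix s)⁻¹ - permMatrix q) =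
      √(2 * ((hammingDist ⇑(s * p * s⁻¹) q : ℝ) / n)) := by
  rw [permMatrix_inv, permMatrix_mul, permMatrix_mul, trNorm_permMatrix_sub]

theorem tendsto_sqrt_two_mul_iff {ι : Type*} {l : Filter ι} {f : ι → ℝ} (hf : ∀ k, 0 ≤ f k) :
    Tendsto (fun k => √(2 * f k)) l (nhds 0) ↔ Tendsto f l (nhds 0) := by
  constructor
  · intro h
    have h2 := (h.pow 2).div_const 2
    simp only [ne_eq, OfNat.ofNat_ne_zero, not_false_eq_true, zero_pow, zero_div] at h2
    refine h2.congr fun k => ?_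
    rw [Real.sq_sqrt (mul_nonneg zero_le_two (hf k))]
    ring
  · intro h
    simpa using (h.const_mul 2).sqrt

end ElekSzabo

/-- **Elek–Szabó criterion.** With `ω` a free ultrafilter on `ℕ`,
`n k → ∞` positive, and `p k, q k` permutations of `{1, …, n k}` with permutation matrices
`P k, Q k`: there is a sequence of permutations `s k` with permutation matrices `S k` such
that `‖S k * P k * (S k)⁻¹ − Q k‖₂ → 0` along `ω` iff for every `i ∈ ℕ*` the sequences
`cyc_i (p k)` and `cyc_i (q k)` converge to the same limit along `ω`. -/
theorem elek_szabo_conjugacy (ω : Ultrafilter ℕ)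
    (hω : (ω : Filter ℕ) ≤ Filter.cofinite)
    (n : ℕ → ℕ) (hn : ∀ k, 0 < n k) (hn' : Tendsto n atTop atTop)
    (p q : ∀ k, Equiv.Perm (Fin (n k))) :
    (∃ s : ∀ k, Equiv.Perm (Fin (n k)),
        Tendsto
          (fun k => trNorm (permMatrix (s k) * permMatrix (p k) * (permMatrix (s k))⁻¹
            - permMatrix (q k)))
          (ω : Filter ℕ) (nhds 0)) ↔
      ∀ i : ℕ, 0 < i → ∃ L : ℝ,
        Tendsto (fun k => cyc (p k) i) (ω : Filter ℕ) (nhds L) ∧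
        Tendsto (fun k => cyc (q k) i) (ω : Filter ℕ) (nhds L) := by
  have hnonneg (s : ∀ k, Equiv.Perm (Fin (n k))) (k : ℕ) :
      0 ≤ (hammingDist ⇑(s k * p k * (s k)⁻¹) (q k) : ℝ) / n k := by positivity
  simp only [ElekSzabo.trNorm_conj_sub]
  simp only [ElekSzabo.tendsto_sqrt_two_mul_iff (hnonneg _)]
  constructor
  · rintro ⟨s, hs⟩ i hi
    obtain ⟨L, -, hL⟩ := isCompact_Icc.ultrafilter_le_nhds (ω.map fun k => cyc (p k) i)
      (le_principal_iff.2 (mem_map.2 (Eventually.of_forall fun k =>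
        ElekSzabo.cyc_mem_Icc (p k) i)))
    have hL' : Tendsto (fun k => cyc (p k) i) (ω : Filter ℕ) (nhds L) := hL
    refine ⟨L, hL', ?_⟩
    have hdiff : Tendsto (fun k => cyc (p k) i - cyc (q k) i) (ω : Filter ℕ) (nhds 0) := by
      refine squeeze_zero_norm (fun k => ?_) (by simpa using hs.const_mul (i : ℝ))
      rw [Real.norm_eq_abs, ← ElekSzabo.cyc_conj (s k) (p k)]
      exact ElekSzabo.abs_cyc_sub_le _ _ hi
    simpa using hL'.sub hdiff
  · intro h
    choose s hs using fun k => Finite.exists_min fun s : Equiv.Perm (Fin (n k)) =>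
      (hammingDist ⇑(s * p k * s⁻¹) (q k) : ℝ) / n k
    refine ⟨s, ?_⟩
    have hbound (m : ℕ) (hm : 0 < m) (k : ℕ) :
        (hammingDist ⇑(s k * p k * (s k)⁻¹) (q k) : ℝ) / n k ≤
          4 * ∑ i ∈ Finset.Icc 1 m, |cyc (p k) i - cyc (q k) i| + 4 / m := by
      obtain ⟨t, ht⟩ := ElekSzabo.exists_conj_hammingDist_div_le (hn k) hm (p k) (q k)
      exact (hs k t).trans ht
    have hlim (m : ℕ) : Tendsto
        (fun k => 4 * ∑ i ∈ Finset.Icc 1 m, |cyc (p k) i - cyc (q k) i| + 4 / (m : ℝ))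
        (ω : Filter ℕ) (nhds (4 / m)) := by
      have hsum : Tendsto (fun k => ∑ i ∈ Finset.Icc 1 m, |cyc (p k) i - cyc (q k) i|)
          (ω : Filter ℕ) (nhds (∑ _i ∈ Finset.Icc 1 m, 0)) := by
        refine tendsto_finsetSum _ fun i hi => ?_
        obtain ⟨L, hp, hq⟩ := h i (Finset.mem_Icc.1 hi).1
        simpa using (hp.sub hq).abs
      simpa using (hsum.const_mul 4).add_const (4 / (m : ℝ))
    refine tendsto_order.2 ⟨fun a ha => Eventually.of_forall fun k =>
      ha.trans_le (hnonneg s k), fun ε hε => ?_⟩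
    obtain ⟨m, hm⟩ := exists_nat_gt (4 / ε)
    have hm0 : (0 : ℝ) < m := (div_pos four_pos hε).trans hm
    have hlt : 4 / (m : ℝ) < ε := (div_lt_comm₀ hε hm0).1 hm
    filter_upwards [(hlim m).eventually_lt_const hlt] with k hk
    exact (hbound m (by exact_mod_cast hm0) k).trans_lt hk
end
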